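/- Let 𝒜 ⊆ ℂ^N be an irreducible algebraic set of positive dimension (equivalently, infinite) and let f : 𝒜 → ℂ^M be a proper polynomial mapping on 𝒜 which is surjective onto ℂ^M (f(𝒜) = ℂ^M). Then for every nonempty compact set K ⊆ ℂ^M and every z ∈ 𝒜: L∞(f|𝒜) · V_{f⁻¹(K)}(z) ≤ V_K(f(z)), where L∞(f|𝒜) is the Łojasiewicz exponent of f at infinity on 𝒜 (a positive real number under these hypotheses) and the convention t·(+∞) = +∞ for t > 0 is used. -/

import Mathlib

open Filter MvPolynomial Metric Set ENNReal

/-- extended logarithm of a nonnegative real number, with `elog 0 = -∞`. -/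
noncomputable def elog (t : ℝ) : EReal := if t = 0 then ⊥ else ((Real.log t : ℝ) : EReal)

/-- the filter of points of `V` whose norm tends to infinity. -/
def atInftyOn {E : Type*} [Norm E] (V : Set E) : Filter E :=
  (Filter.comap (fun z => ‖z‖) Filter.atTop) ⊓ Filter.principal V

/-- the quotient `log ‖f z‖ / log ‖z‖`, computed in the extended reals. -/
noncomputable def logRatio {E F : Type*} [Norm E] [Norm F] (f : E → F) (z : E) : EReal :=
  elog ‖f z‖ / elog ‖z‖

/-- the growth exponent `ρ(f, V)` of `f` on `V`. -/
noncomputable def growthExp {E F : Type*} [Norm E] [Norm F] (f : E → F) (V : Set E) : EReal :=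
  Filter.limsup (logRatio f) (atInftyOn V)

/-- `log ‖f⁻¹(w)‖ = log sup {‖z‖ : z ∈ V, f z = w}`, computed in the extended reals
(`-∞` for an empty fiber). -/
noncomputable def fiberLogNorm {E F : Type*} [Norm E] [Norm F] (f : E → F) (V : Set E)
    (w : F) : EReal :=
  sSup ((fun z => elog ‖z‖) '' {z | z ∈ V ∧ f z = w})

/-- the order `ρ(f⁻¹, f(V))` of `f` on `V`: the growth exponent of the multifunction `f⁻¹`
on `f(V)`. -/
noncomputable def orderExp {E F : Type*} [Norm E] [Norm F] (f : E → F) (V : Set E) : EReal :=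
  Filter.limsup (fun w => fiberLogNorm f V w / elog ‖w‖) (atInftyOn (f '' V))

/-- the Łojasiewicz exponent at infinity `L∞(f|V)`, with `sup ∅ = -∞`. -/
noncomputable def lojExp {E F : Type*} [Norm E] [Norm F] (f : E → F) (V : Set E) : EReal :=
  sSup {x : EReal | ∃ d : ℝ, x = (d : EReal) ∧
    ∃ C : ℝ, 0 < C ∧ ∃ R : ℝ, 0 < R ∧ ∀ z ∈ V, R < ‖z‖ → C * ‖z‖ ^ d < ‖f z‖}

/-- inverse on `[0,+∞] ⊆ EReal` with the conventions `1/∞ = 0` and `1/0 = ∞`. -/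
noncomputable def invE (x : EReal) : EReal :=
  if x = ⊤ then 0 else if x = 0 then ⊤ else (((x.toReal)⁻¹ : ℝ) : EReal)

/-- evaluation of a polynomial of `n` variables at a point of `ℂⁿ`. -/
noncomputable def evalAt {n : ℕ} (z : EuclideanSpace ℂ (Fin n))
    (p : MvPolynomial (Fin n) ℂ) : ℂ :=
  MvPolynomial.eval (fun i => z i) p

/-- an algebraic subset of `ℂⁿ`: the common zero set of finitely many polynomials. -/
def IsAlgebraicSet {n : ℕ} (A : Set (EuclideanSpace ℂ (Fin n))) : Prop :=
  ∃ S : Finset (MvPolynomial (Fin n) ℂ), A = {z | ∀ p ∈ S, evalAt z p = 0}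

/-- the ideal of all polynomials vanishing identically on `A`. -/
noncomputable def vanishIdeal {n : ℕ} (A : Set (EuclideanSpace ℂ (Fin n))) :
    Ideal (MvPolynomial (Fin n) ℂ) :=
  RingHom.ker (Pi.ringHom fun z : A =>
    MvPolynomial.eval (fun i => (z : EuclideanSpace ℂ (Fin n)) i))

/-- a polynomial mapping on `A`: the restriction to `A` of a mapping all of whose
components are polynomials. -/
def IsPolyMapOn {N M : ℕ} (f : EuclideanSpace ℂ (Fin N) → EuclideanSpace ℂ (Fin M))
    (A : Set (EuclideanSpace ℂ (Fin N))) : Prop :=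
  ∃ P : Fin M → MvPolynomial (Fin N) ℂ, ∀ z ∈ A, ∀ j, f z j = evalAt z (P j)

/-- a holomorphic mapping on `A`: locally the restriction of a holomorphic mapping on an
open subset of the ambient space. -/
def IsHoloOn {N M : ℕ} (f : EuclideanSpace ℂ (Fin N) → EuclideanSpace ℂ (Fin M))
    (A : Set (EuclideanSpace ℂ (Fin N))) : Prop :=
  ∀ z ∈ A, ∃ U : Set (EuclideanSpace ℂ (Fin N)), IsOpen U ∧ z ∈ U ∧
    ∃ F : EuclideanSpace ℂ (Fin N) → EuclideanSpace ℂ (Fin M),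
      DifferentiableOn ℂ F U ∧ Set.EqOn f F (U ∩ A)

/-- the pluricomplex Green function of a compact set `K ⊆ ℂⁿ`, in its Siciak–Zaharjuta
polynomial form `V_K(z) = sup { (deg q)⁻¹ · log⁺ |q(z)| }`. -/
noncomputable def greenV {n : ℕ} (K : Set (EuclideanSpace ℂ (Fin n)))
    (z : EuclideanSpace ℂ (Fin n)) : EReal :=
  sSup {x : EReal | ∃ q : MvPolynomial (Fin n) ℂ, 1 ≤ q.totalDegree ∧
    (∀ w ∈ K, ‖evalAt w q‖ ≤ 1) ∧
    x = (((q.totalDegree : ℝ)⁻¹ * max (Real.log ‖evalAt z q‖) 0 : ℝ) : EReal)}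


lemma A1 {B : Type*} [CommRing B] [Algebra ℂ B] [Algebra.FiniteType ℂ B] (Q : Ideal B)
    [hQ : Q.IsMaximal] : ∃ φ : B →ₐ[ℂ] ℂ, ∀ b, φ b = 0 ↔ b ∈ Q := by
  let : Field (B ⧸ Q) := Ideal.Quotient.field Q
  have : Algebra.FiniteType ℂ (B ⧸ Q) := Algebra.FiniteType.of_surjective (Ideal.Quotient.mkₐ ℂ Q) (Ideal.Quotient.mkₐ_surjective _ _)
  have := finite_of_finite_type_of_isJacobsonRing ℂ (B ⧸ Q)
  let e := AlgEquiv.ofBijective (Algebra.ofId ℂ (B ⧸ Q)) (IsAlgClosed.algebraMap_bijective_of_isIntegral)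
  refine ⟨e.symm.toAlgHom.comp (Ideal.Quotient.mkₐ ℂ Q), fun b => ?_⟩
  simp [Ideal.Quotient.eq_zero_iff_mem]

lemma A2 {B R' : Type*} [CommRing B] [Algebra ℂ B] [Algebra.FiniteType ℂ B] [CommRing R']
    (g : R' →+* B) (ψ : R' →+* ℂ) (c : ℂ →+* R') (hgc : ∀ a, g (c a) = algebraMap ℂ B a)
    (hψc : ∀ a, ψ (c a) = a) (Q : Ideal B) [hQ : Q.IsMaximal]
    (hcomap : ∀ F, g F ∈ Q ↔ ψ F = 0) : ∃ φ : B →ₐ[ℂ] ℂ, ∀ F, φ (g F) = ψ F := by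
  obtain ⟨φ, hφ⟩ := A1 Q
  refine ⟨φ, fun F => ?_⟩
  have h : g (F - c (ψ F)) ∈ Q := by rw [hcomap]; simp [hψc]
  rw [← hφ, map_sub, map_sub, hgc, AlgHom.commutes] at h
  simpa [sub_eq_zero] using h


lemma A3 {B R' : Type*} [CommRing B] [IsDomain B] [Algebra ℂ B] [Algebra.FiniteType ℂ B]
    [CommRing R'] [IsNoetherianRing R'] (g : R' →+* B) (hg : g.FiniteType)
    (c : ℂ →+* R') (hgc : ∀ a, g (c a) = algebraMap ℂ B a) :
    ∃ h : R', g h ≠ 0 ∧ ∀ ψ : R' →+* ℂ, (∀ a, ψ (c a) = a) → (∀ F, g F = 0 → ψ F = 0) →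
      ψ h ≠ 0 → ∃ φ : B →ₐ[ℂ] ℂ, ∀ F, φ (g F) = ψ F := by
  have hfp : g.FinitePresentation := RingHom.FinitePresentation.of_finiteType.mp hg
  obtain ⟨S, hS⟩ := PrimeSpectrum.exists_constructibleSetData_iff.mpr
    (PrimeSpectrum.isConstructible_range_comap hfp)
  have hbot : PrimeSpectrum.comap g ⊥ ∈ S.toSet := by rw [hS]; exact ⟨_, rfl⟩
  simp only [PrimeSpectrum.ConstructibleSetData.toSet, Set.mem_iUnion] at hbot
  obtain ⟨D, hD, hbot⟩ := hbot
  simp only [PrimeSpectrum.BasicConstructibleSetData.toSet, Set.mem_sdiff,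
    PrimeSpectrum.mem_zeroLocus, Set.range_subset_iff, Set.singleton_subset_iff] at hbot
  refine ⟨D.f, fun h0 => hbot.2 (by simp [h0]), fun ψ hψc hker hψ => ?_⟩
  have hsurj : Function.Surjective ψ := fun a => ⟨c a, hψc a⟩
  have hmax : (RingHom.ker ψ).IsMaximal := RingHom.ker_isMaximal_of_surjective ψ hsurj
  let n : PrimeSpectrum R' := ⟨RingHom.ker ψ, hmax.isPrime⟩
  have hn : n ∈ S.toSet := by
    simp only [PrimeSpectrum.ConstructibleSetData.toSet, Set.mem_iUnion]
    refine ⟨D, hD, ?_⟩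
    simp only [PrimeSpectrum.BasicConstructibleSetData.toSet, Set.mem_sdiff,
      PrimeSpectrum.mem_zeroLocus, Set.range_subset_iff, Set.singleton_subset_iff]
    refine ⟨fun i => hker _ ?_, fun h => hψ h⟩
    have := hbot.1 i
    simpa using this
  rw [hS] at hn
  obtain ⟨q, hq⟩ := hn
  obtain ⟨Q, hQ, hqQ⟩ := Ideal.exists_le_maximal q.asIdeal q.isPrime.ne_top
  have h1 : RingHom.ker ψ = Ideal.comap g q.asIdeal := by
    have := congrArg PrimeSpectrum.asIdeal hq
    simpa using this.symm
  have h2 : RingHom.ker ψ = Ideal.comap g Q := by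
    refine hmax.eq_of_le (Ideal.comap_ne_top g hQ.ne_top) ?_
    rw [h1]
    exact Ideal.comap_mono hqQ
  exact A2 g ψ c hgc hψc Q (fun F => by
    rw [← RingHom.mem_ker, h2, Ideal.mem_comap])

lemma dense_ne_zero {M : ℕ} (D : MvPolynomial (Fin M) ℂ) (hD : D ≠ 0) :
    Dense {w : Fin M → ℂ | eval w D ≠ 0} := by
  intro w0
  rw [Metric.mem_closure_iff]
  intro ε hε
  by_contra hcon
  push Not at hcon
  apply hD
  refine funext_set (fun i => Metric.ball (w0 i) ε) (fun i => ?_) ?_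
  · exact infinite_of_mem_nhds (w0 i) (Metric.ball_mem_nhds _ hε)
  · intro x hx
    by_contra hne
    have h := hcon x (by simpa using hne)
    rw [dist_comm] at h
    have : dist x w0 < ε := by
      rw [dist_pi_lt_iff hε]
      intro i
      exact hx i (Set.mem_univ i)
    linarith

lemma cont_eval {M : ℕ} (D : MvPolynomial (Fin M) ℂ) :
    Continuous (fun w : Fin M → ℂ => eval w D) := MvPolynomial.continuous_eval D

/-- extend an inequality from a dense set -/
lemma ineq_extend {M : ℕ} (D : MvPolynomial (Fin M) ℂ) (hD : D ≠ 0) (w0 : Fin M → ℂ)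
    (u v : (Fin M → ℂ) → ℝ) (hu : Continuous u) (hv : Continuous v)
    (h : ∀ᶠ w in nhds w0, eval w D ≠ 0 → u w ≤ v w) : ∀ᶠ w in nhds w0, u w ≤ v w := by
  obtain ⟨U, hUs, hU, hwU⟩ := _root_.mem_nhds_iff.mp h
  refine _root_.mem_nhds_iff.mpr ⟨U, fun w hw => ?_, hU, hwU⟩
  have hcl : IsClosed {w | u w ≤ v w} := isClosed_le hu hv
  have h1 : U ⊆ closure (U ∩ {w : Fin M → ℂ | eval w D ≠ 0}) :=
    (dense_ne_zero D hD).open_subset_closure_inter hU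
  have h2 : closure (U ∩ {w : Fin M → ℂ | eval w D ≠ 0}) ⊆ {w | u w ≤ v w} := by
    apply hcl.closure_subset_iff.mpr
    intro x hx
    exact hUs hx.1 hx.2
  exact h2 (h1 hw)

lemma A4 {M : ℕ} (a : MvPolynomial (Fin M) ℂ) : a ≠ 0 → ∀ c : MvPolynomial (Fin M) ℂ,
    (∀ w0 : Fin M → ℂ, ∃ C : ℝ, ∀ᶠ w in nhds w0, ‖eval w c‖ ≤ C * ‖eval w a‖) → a ∣ c := by
  induction a using UniqueFactorizationMonoid.induction_on_prime with
  | h₁ => intro h; exact absurd rfl h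
  | h₂ x hx => intro _ c _; exact hx.dvd
  | h₃ a p ha hp ih =>
    intro _ c hc
    have hpc : p ∣ c := by
      have hpr : (Ideal.span {p}).IsPrime := (Ideal.span_singleton_prime hp.ne_zero).mpr hp
      rw [← Ideal.mem_span_singleton, ← IsPrime.vanishingIdeal_zeroLocus (K := ℂ) (Ideal.span {p}),
        mem_vanishingIdeal_iff]
      intro w hw
      rw [mem_zeroLocus_iff] at hw
      have hpw := hw p (Ideal.mem_span_singleton_self p)
      obtain ⟨C, hC⟩ := hc w
      have := hC.self_of_nhds
      have hpw' : eval w p = 0 := by simpa using hpw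
      have hc0 : eval w c = 0 := by simpa [hpw'] using this
      simpa using hc0
    obtain ⟨c', rfl⟩ := hpc
    refine mul_dvd_mul_left p (ih ha c' fun w0 => ?_)
    obtain ⟨C, hC⟩ := hc w0
    refine ⟨C, ineq_extend p hp.ne_zero w0 _ _ (cont_eval c').norm
      (continuous_const.mul (cont_eval a).norm) ?_⟩
    filter_upwards [hC] with w hw hpw
    have : 0 < ‖eval w p‖ := norm_pos_iff.mpr hpw
    rw [map_mul, map_mul, norm_mul, norm_mul] at hw
    nlinarith


/-- evaluation of a polynomial over `ℂ[w]` at a point `(w, t)`. -/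
noncomputable def evWT {M : ℕ} (w : Fin M → ℂ) (t : ℂ) :
    Polynomial (MvPolynomial (Fin M) ℂ) →+* ℂ :=
  Polynomial.eval₂RingHom (eval w) t

lemma evWT_apply {M : ℕ} (w : Fin M → ℂ) (t : ℂ) (F : Polynomial (MvPolynomial (Fin M) ℂ)) :
    evWT w t F = (F.map (eval w)).eval t := by
  simp [evWT, Polynomial.eval_map]

lemma pseudo_div {R : Type*} [CommRing R] [IsDomain R] (P : Polynomial R) (I : Ideal (Polynomial R))
    (hP : P ∈ I) (hP0 : 0 < P.natDegree)
    (hmin : ∀ F ∈ I, F ≠ 0 → P.natDegree ≤ F.natDegree) (n : ℕ) :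
    ∀ F ∈ I, F.natDegree ≤ n → ∃ k : ℕ, P ∣ Polynomial.C P.leadingCoeff ^ k * F := by
  induction n with
  | zero =>
    intro F hF hn
    have : F = 0 := by
      by_contra h
      have := hmin F hF h
      omega
    exact ⟨0, by simp [this]⟩
  | succ n ih =>
    intro F hF hn
    by_cases h0 : F = 0
    · exact ⟨0, by simp [h0]⟩
    have hle := hmin F hF h0
    have hlt := Polynomial.natDegree_cancelLeads_lt_of_natDegree_le_natDegree hle (by omega)
    have hmem : P.cancelLeads F ∈ I := by
      unfold Polynomial.cancelLeads
      exact I.sub_mem (I.mul_mem_left _ hF) (I.mul_mem_left _ hP)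
    obtain ⟨k, hk⟩ := ih _ hmem (by omega)
    refine ⟨k + 1, ?_⟩
    unfold Polynomial.cancelLeads at hk
    rw [Nat.sub_eq_zero_of_le hle, pow_zero, mul_one, mul_sub] at hk
    have h2 : P ∣ Polynomial.C P.leadingCoeff ^ k *
        (Polynomial.C F.leadingCoeff * Polynomial.X ^ (F.natDegree - P.natDegree) * P) :=
      ⟨Polynomial.C P.leadingCoeff ^ k * (Polynomial.C F.leadingCoeff * Polynomial.X ^ (F.natDegree - P.natDegree)), by ring⟩
    have := (dvd_sub_left h2).mp hk
    rwa [← mul_assoc, ← pow_succ] at this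

theorem A5 {M : ℕ} {B : Type*} [CommRing B] [IsDomain B] [Algebra ℂ B] [Algebra.FiniteType ℂ B]
    [Algebra (MvPolynomial (Fin M) ℂ) B] [IsScalarTower ℂ (MvPolynomial (Fin M) ℂ) B]
    (hinj : Function.Injective (algebraMap (MvPolynomial (Fin M) ℂ) B))
    (hbd : ∀ x : B, ∀ w0 : Fin M → ℂ, ∃ C : ℝ, ∀ᶠ w in nhds w0, ∀ φ : B →ₐ[ℂ] ℂ,
      (∀ r, φ (algebraMap (MvPolynomial (Fin M) ℂ) B r) = eval w r) → ‖φ x‖ ≤ C) (x : B) :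
    IsIntegral (MvPolynomial (Fin M) ℂ) x := by
  have hfs : FaithfulSMul (MvPolynomial (Fin M) ℂ) B := (faithfulSMul_iff_algebraMap_injective _ _).mpr hinj
  have htf : Module.IsTorsionFree (MvPolynomial (Fin M) ℂ) B := inferInstance
  let g : Polynomial (MvPolynomial (Fin M) ℂ) →+* B :=
    (Polynomial.aeval x : Polynomial (MvPolynomial (Fin M) ℂ) →ₐ[MvPolynomial (Fin M) ℂ] B).toRingHom
  have hgdef : ∀ F, g F = Polynomial.aeval x F := fun F => rfl
  let c : ℂ →+* Polynomial (MvPolynomial (Fin M) ℂ) := Polynomial.C.comp MvPolynomial.C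
  have hcdef : ∀ a, c a = Polynomial.C (MvPolynomial.C a) := fun a => rfl
  have hgc : ∀ a, g (c a) = algebraMap ℂ B a := by
    intro a
    rw [hgdef, hcdef, Polynomial.aeval_C, IsScalarTower.algebraMap_apply ℂ (MvPolynomial (Fin M) ℂ) B]
    rfl
  have hψc : ∀ w t a, evWT (M := M) w t (c a) = a := by
    intro w t a
    simp [evWT_apply, hcdef]
  have hg : g.FiniteType := by
    apply RingHom.FiniteType.of_comp_finiteType (f := c)
    have : g.comp c = algebraMap ℂ B := RingHom.ext hgc
    rw [this]
    exact RingHom.finiteType_algebraMap.mpr inferInstance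
  obtain ⟨h, hh, hlift⟩ := A3 g hg c hgc
  have hlift' : ∀ w t, (∀ F, g F = 0 → evWT w t F = 0) → evWT w t h ≠ 0 → ∃ φ : B →ₐ[ℂ] ℂ,
      (∀ r, φ (algebraMap (MvPolynomial (Fin M) ℂ) B r) = eval w r) ∧ φ x = t := by
    intro w t h1 h2
    obtain ⟨φ, hφ⟩ := hlift (evWT w t) (hψc w t) h1 h2
    refine ⟨φ, fun r => ?_, ?_⟩
    · have := hφ (Polynomial.C r)
      simpa [hgdef, evWT_apply] using this
    · have := hφ Polynomial.X
      simpa [hgdef, evWT_apply] using this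
  -- x is algebraic
  have halg : IsAlgebraic (MvPolynomial (Fin M) ℂ) x := by
    by_contra htr
    have hker : ∀ F, g F = 0 → F = 0 := by
      intro F hF
      by_contra hF0
      exact htr ⟨F, hF0, hF⟩
    have hh0 : h ≠ 0 := by
      rintro rfl
      simp at hh
    obtain ⟨w, hw⟩ : ∃ w : Fin M → ℂ, eval w h.leadingCoeff ≠ 0 := by
      by_contra hcon
      push Not at hcon
      exact hh0 (Polynomial.leadingCoeff_eq_zero.mp (MvPolynomial.funext (by simpa using hcon)))
    have hmap : h.map (eval w) ≠ 0 := by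
      intro h0
      apply hw
      have := congrArg (fun p => Polynomial.coeff p h.natDegree) h0
      simpa using this
    obtain ⟨C, hC⟩ := hbd x w
    have hC := hC.self_of_nhds
    have hfin : {t : ℂ | (h.map (eval w)).IsRoot t}.Finite := Polynomial.finite_setOfPred_isRoot hmap
    have hbdd : Bornology.IsBounded (Set.univ : Set ℂ) := by
      have : (Set.univ : Set ℂ) ⊆ {t : ℂ | (h.map (eval w)).IsRoot t} ∪ Metric.closedBall 0 C := by
        intro t _
        by_cases ht : (h.map (eval w)).IsRoot t
        · exact Or.inl ht
        · right
          obtain ⟨φ, h1, h2⟩ := hlift' w t (fun F hF => by rw [hker F hF, map_zero])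
            (by rw [evWT_apply]; exact ht)
          simpa [h2] using hC φ h1
      exact (hfin.isBounded.union Metric.isBounded_closedBall).subset this
    exact NormedSpace.unbounded_univ ℂ ℂ hbdd
  -- minimal polynomial
  obtain ⟨P, ⟨hP0, hPx⟩, hPmin'⟩ : ∃ P : Polynomial (MvPolynomial (Fin M) ℂ),
      (P ≠ 0 ∧ Polynomial.aeval x P = 0) ∧ ∀ F, F ≠ 0 → Polynomial.aeval x F = 0 →
        P.natDegree ≤ F.natDegree := by
    let T : Set (Polynomial (MvPolynomial (Fin M) ℂ)) := {P | P ≠ 0 ∧ Polynomial.aeval x P = 0}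
    have hT : T.Nonempty := halg
    refine ⟨Function.argminOn (fun P => P.natDegree) T hT, Function.argminOn_mem _ T hT, ?_⟩
    intro F h1 h2
    exact Function.argminOn_le (fun P => P.natDegree) T (show F ∈ T from ⟨h1, h2⟩)
  have hdeg : 0 < P.natDegree := by
    by_contra h0
    have h0 : P.natDegree = 0 := by omega
    rw [Polynomial.eq_C_of_natDegree_eq_zero h0, Polynomial.aeval_C] at hPx
    have : P.coeff 0 = 0 := hinj (by simpa using hPx)
    apply hP0
    rw [Polynomial.eq_C_of_natDegree_eq_zero h0, this, map_zero]
  have ha0 : P.leadingCoeff ≠ 0 := Polynomial.leadingCoeff_ne_zero.mpr hP0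
  -- the element h divides something in R
  obtain ⟨r, hr0, u, hu⟩ : ∃ r : MvPolynomial (Fin M) ℂ, r ≠ 0 ∧
      ∃ u : Polynomial (MvPolynomial (Fin M) ℂ), g (Polynomial.C r - h * u) = 0 := by
    let S := Algebra.adjoin (MvPolynomial (Fin M) ℂ) {x}
    have hmem : ∀ F, g F ∈ S := fun F => Polynomial.aeval_mem_adjoin_singleton _ x
    have hSalg : IsAlgebraic (MvPolynomial (Fin M) ℂ) (⟨g h, hmem h⟩ : S) := by
      have h1 : IsAlgebraic (MvPolynomial (Fin M) ℂ) (g h) := by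
        exact (Algebra.isAlgebraic_adjoin_singleton_iff.mpr halg) _ (hmem h)
      exact (isAlgebraic_algHom_iff S.val Subtype.val_injective).mp h1
    obtain ⟨r, hr, v, hv⟩ := hSalg.exists_nonzero_dvd (mem_nonZeroDivisors_of_ne_zero (by
      intro h0; exact hh (congrArg Subtype.val h0)))
    obtain ⟨v, hvS⟩ := v
    obtain ⟨u, rfl⟩ := (Algebra.adjoin_singleton_eq_range_aeval (MvPolynomial (Fin M) ℂ) x).le hvS
    refine ⟨r, hr, u, ?_⟩
    have := congrArg Subtype.val hv
    simp only [map_sub, map_mul, sub_eq_zero]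
    simpa [hgdef] using this
  have hroot : ∀ w, eval w (P.leadingCoeff * r) ≠ 0 → ∀ t ∈ (P.map (eval w)).roots,
      ∃ φ : B →ₐ[ℂ] ℂ,
      (∀ r, φ (algebraMap (MvPolynomial (Fin M) ℂ) B r) = eval w r) ∧ φ x = t := by
    intro w hw t ht
    rw [map_mul] at hw
    have hw1 := left_ne_zero_of_mul hw
    have hw2 := right_ne_zero_of_mul hw
    have hPt : evWT w t P = 0 := by
      rw [evWT_apply]
      exact Polynomial.isRoot_of_mem_roots ht
    have hker : ∀ F, g F = 0 → evWT w t F = 0 := by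
      intro F hF
      obtain ⟨k, G, hG⟩ := pseudo_div P (RingHom.ker g) hPx hdeg
        (fun F hF hF0 => hPmin' F hF0 hF) F.natDegree F hF le_rfl
      have := congrArg (evWT w t) hG
      rw [map_mul, map_mul, hPt, zero_mul, map_pow] at this
      have h3 : evWT w t (Polynomial.C P.leadingCoeff) ≠ 0 := by
        simpa [evWT_apply] using hw1
      simpa [h3] using this
    refine hlift' w t hker ?_
    intro h0
    have h4 := hker _ hu
    rw [map_sub, map_mul, h0, zero_mul, sub_zero] at h4
    apply hw2
    simpa [evWT_apply] using h4
  refine (minpoly.IsIntegrallyClosed.isIntegral_iff_leadingCoeff_dvd hPx hP0 ?_).mpr ?_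
  · intro q hq hqx
    rw [Polynomial.degree_eq_natDegree hP0, Polynomial.degree_eq_natDegree hq.ne_zero]
    exact_mod_cast hPmin' q hq.ne_zero hqx
  · rw [Polynomial.C_dvd_iff_dvd_coeff]
    intro i
    refine A4 _ ha0 _ fun w0 => ?_
    obtain ⟨C, hC⟩ := hbd x w0
    refine ⟨C ^ (P.natDegree - i) * (P.natDegree.choose i), ineq_extend (P.leadingCoeff * r) (mul_ne_zero ha0 hr0) w0 _ _
      (cont_eval _).norm (continuous_const.mul (cont_eval _).norm) ?_⟩
    filter_upwards [hC] with w hw hwD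
    have hw1 : eval w P.leadingCoeff ≠ 0 := by
      rw [map_mul] at hwD
      exact left_ne_zero_of_mul hwD
    have hnd : (P.map (eval w)).natDegree = P.natDegree :=
      Polynomial.natDegree_map_of_leadingCoeff_ne_zero _ hw1
    have hlc : (P.map (eval w)).leadingCoeff = eval w P.leadingCoeff :=
      Polynomial.leadingCoeff_map_of_leadingCoeff_ne_zero _ hw1
    let p : Polynomial ℂ := Polynomial.C (eval w P.leadingCoeff)⁻¹ * P.map (eval w)
    have hpm : p.Monic := by
      simp only [p, Polynomial.Monic, Polynomial.leadingCoeff_mul, hlc, Polynomial.leadingCoeff_C]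
      exact inv_mul_cancel₀ hw1
    have hpd : p.natDegree = P.natDegree := by
      simp only [p]
      rw [Polynomial.natDegree_C_mul (inv_ne_zero hw1), hnd]
    have := Polynomial.coeff_le_of_roots_le (f := RingHom.id ℂ) (B := C) i hpm
      (IsAlgClosed.splits _) (by
        intro t ht
        rw [Polynomial.map_id, Polynomial.roots_C_mul _ (inv_ne_zero hw1)] at ht
        obtain ⟨φ, h1, h2⟩ := hroot w hwD t ht
        rw [← h2]
        exact hw φ h1)
    rw [Polynomial.map_id, hpd] at this
    simp only [p, Polynomial.coeff_C_mul, Polynomial.coeff_map, norm_mul, norm_inv] at this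
    rwa [inv_mul_le_iff₀ (norm_pos_iff.mpr hw1), mul_comm] at this


lemma A6 {M : ℕ} {B : Type*} [CommRing B] [IsDomain B] [Algebra ℂ B] [Algebra.FiniteType ℂ B]
    [Algebra (MvPolynomial (Fin M) ℂ) B] [IsScalarTower ℂ (MvPolynomial (Fin M) ℂ) B]
    (hinj : Function.Injective (algebraMap (MvPolynomial (Fin M) ℂ) B))
    (hIntegral : ∀ x : B, IsIntegral (MvPolynomial (Fin M) ℂ) x) (x : B) (w : Fin M → ℂ) (t : ℂ)
    (ht : evWT w t (minpoly (MvPolynomial (Fin M) ℂ) x) = 0) : ∃ φ : B →ₐ[ℂ] ℂ,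
      (∀ r, φ (algebraMap (MvPolynomial (Fin M) ℂ) B r) = eval w r) ∧ φ x = t := by
  have hfs : FaithfulSMul (MvPolynomial (Fin M) ℂ) B := (faithfulSMul_iff_algebraMap_injective _ _).mpr hinj
  have htf : Module.IsTorsionFree (MvPolynomial (Fin M) ℂ) B := inferInstance
  let g : Polynomial (MvPolynomial (Fin M) ℂ) →+* B :=
    (Polynomial.aeval x : Polynomial (MvPolynomial (Fin M) ℂ) →ₐ[MvPolynomial (Fin M) ℂ] B).toRingHom
  have hgdef : ∀ F, g F = Polynomial.aeval x F := fun F => rfl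
  let c : ℂ →+* Polynomial (MvPolynomial (Fin M) ℂ) := Polynomial.C.comp MvPolynomial.C
  have hcdef : ∀ a, c a = Polynomial.C (MvPolynomial.C a) := fun a => rfl
  have hgc : ∀ a, g (c a) = algebraMap ℂ B a := by
    intro a
    rw [hgdef, hcdef, Polynomial.aeval_C, IsScalarTower.algebraMap_apply ℂ (MvPolynomial (Fin M) ℂ) B]
    rfl
  have hψc : ∀ a, evWT (M := M) w t (c a) = a := by
    intro a
    simp [evWT_apply, hcdef]
  have hmax : (RingHom.ker (evWT w t)).IsMaximal :=
    RingHom.ker_isMaximal_of_surjective _ (fun a => ⟨c a, hψc a⟩)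
  let alg : Algebra (Polynomial (MvPolynomial (Fin M) ℂ)) B := g.toAlgebra
  have hI : Algebra.IsIntegral (Polynomial (MvPolynomial (Fin M) ℂ)) B := by
    constructor
    intro y
    obtain ⟨p, hp, hpy⟩ := hIntegral y
    refine ⟨p.map Polynomial.C, hp.map _, ?_⟩
    rw [Polynomial.eval₂_map]
    have : (algebraMap (Polynomial (MvPolynomial (Fin M) ℂ)) B).comp Polynomial.C = algebraMap (MvPolynomial (Fin M) ℂ) B := by
      apply RingHom.ext
      intro r
      show g (Polynomial.C r) = _
      simp [hgdef]
    rw [this, hpy]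
  obtain ⟨Q, hQ, hQc⟩ := Ideal.exists_ideal_over_maximal_of_isIntegral (S := B) (RingHom.ker (evWT w t)) (by
    intro F hF
    have hF : Polynomial.aeval x F = 0 := hF
    obtain ⟨G, rfl⟩ := minpoly.isIntegrallyClosed_dvd (hIntegral x) hF
    rw [RingHom.mem_ker, map_mul, ht, zero_mul])
  obtain ⟨φ, hφ⟩ := A2 g (evWT w t) c hgc hψc Q (fun F => by
    rw [← RingHom.mem_ker, ← hQc, Ideal.mem_comap]; rfl)
  refine ⟨φ, fun r => ?_, ?_⟩
  · have := hφ (Polynomial.C r)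
    simpa [hgdef, evWT_apply] using this
  · have := hφ Polynomial.X
    simpa [hgdef, evWT_apply] using this

lemma fieldDeg {K L : Type*} [Field K] [Field L] [Algebra K L] (y : L) (hy : IsIntegral K y)
    (k : ℕ) : (minpoly K (y ^ k)).natDegree ≤ (minpoly K y).natDegree := by
  have hfd := IntermediateField.adjoin.finiteDimensional hy
  rw [← IntermediateField.adjoin.finrank hy]
  have := minpoly.natDegree_le (A := K) ((IntermediateField.AdjoinSimple.gen K y) ^ k)
  rwa [← minpoly.algebraMap_eq (algebraMap (IntermediateField.adjoin K {y}) L).injective,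
    map_pow, IntermediateField.AdjoinSimple.algebraMap_gen] at this

lemma A7 {R B : Type*} [CommRing R] [IsDomain R] [IsIntegrallyClosed R] [CommRing B] [IsDomain B]
    [Algebra R B] [FaithfulSMul R B]
    (hIntegral : ∀ x : B, IsIntegral R x) (x : B) (k : ℕ) :
    (minpoly R (x ^ k)).natDegree ≤ (minpoly R x).natDegree := by
  have htf : Module.IsTorsionFree R B := inferInstance
  let K := FractionRing R
  let L := FractionRing B
  let _ : Algebra K L := FractionRing.liftAlgebra R L
  have h1 := minpoly.isIntegrallyClosed_eq_field_fractions K L (hIntegral x)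
  have h2 := minpoly.isIntegrallyClosed_eq_field_fractions K L (hIntegral (x ^ k))
  have e1 : (minpoly K (algebraMap B L x)).natDegree = (minpoly R x).natDegree := by
    rw [h1, (minpoly.monic (hIntegral x)).natDegree_map]
  have e2 : (minpoly K (algebraMap B L (x ^ k))).natDegree = (minpoly R (x ^ k)).natDegree := by
    rw [h2, (minpoly.monic (hIntegral (x ^ k))).natDegree_map]
  have hxi : IsIntegral K (algebraMap B L x) := ((hIntegral x).algebraMap (B := L)).tower_top
  rw [← e1, ← e2, map_pow]
  exact fieldDeg _ hxi k


lemma continuous_evalAt {n : ℕ} (p : MvPolynomial (Fin n) ℂ) :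
    Continuous (fun z : EuclideanSpace ℂ (Fin n) => evalAt z p) := by
  unfold evalAt
  exact (MvPolynomial.continuous_eval p).comp (by fun_prop)

theorem keyProp {N M : ℕ} (A : Set (EuclideanSpace ℂ (Fin N)))
    (f : EuclideanSpace ℂ (Fin N) → EuclideanSpace ℂ (Fin M))
    (halg : IsAlgebraicSet A) (hprime : (vanishIdeal A).IsPrime)
    (hpoly : IsPolyMapOn f A)
    (hproper : ∀ K : Set (EuclideanSpace ℂ (Fin M)), IsCompact K → IsCompact (A ∩ f ⁻¹' K))
    (hsurj : f '' A = Set.univ) (q : MvPolynomial (Fin N) ℂ) :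
    ∃ m : ℕ, ∀ k : ℕ, ∃ P : Polynomial (MvPolynomial (Fin M) ℂ), P.Monic ∧ P.natDegree ≤ m ∧
      (∀ z ∈ A, (P.map (eval (fun i => f z i))).eval (evalAt z q ^ k) = 0) ∧
      ∀ (w : EuclideanSpace ℂ (Fin M)) (t : ℂ), (P.map (eval (fun i => w i))).eval t = 0 →
        ∃ z ∈ A, f z = w ∧ evalAt z q ^ k = t := by
  obtain ⟨P, hP⟩ := hpoly
  obtain ⟨S, hS⟩ := halg
  let B := MvPolynomial (Fin N) ℂ ⧸ vanishIdeal A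
  have hdom : IsDomain B := Ideal.Quotient.isDomain _
  have hmemI : ∀ p : MvPolynomial (Fin N) ℂ, p ∈ vanishIdeal A ↔ ∀ z ∈ A, evalAt z p = 0 := by
    intro p
    unfold vanishIdeal evalAt
    rw [RingHom.mem_ker]
    constructor
    · intro h z hz
      exact congrFun h ⟨z, hz⟩
    · intro h
      funext z
      exact h z z.2
  let mk : MvPolynomial (Fin N) ℂ →ₐ[ℂ] B := Ideal.Quotient.mkₐ ℂ (vanishIdeal A)
  have hmk : Function.Surjective mk := Ideal.Quotient.mkₐ_surjective _ _
  have hmk0 : ∀ p, p ∈ vanishIdeal A → mk p = 0 := fun p hp =>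
    Ideal.Quotient.eq_zero_iff_mem.mpr hp
  have hft : Algebra.FiniteType ℂ B := Algebra.FiniteType.of_surjective mk hmk
  let θ : MvPolynomial (Fin M) ℂ →ₐ[ℂ] B := aeval (fun j => mk (P j))
  let alg : Algebra (MvPolynomial (Fin M) ℂ) B := θ.toRingHom.toAlgebra
  have halgθ : ∀ r, algebraMap (MvPolynomial (Fin M) ℂ) B r = θ r := fun r => rfl
  have htow : IsScalarTower ℂ (MvPolynomial (Fin M) ℂ) B := by
    apply IsScalarTower.of_algebraMap_eq
    intro a
    rw [halgθ]
    exact (θ.commutes a).symm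
  -- points of A give homs
  have hpt : ∀ z ∈ A, ∃ φ : B →ₐ[ℂ] ℂ, (∀ p, φ (mk p) = evalAt z p) ∧
      ∀ r, φ (algebraMap (MvPolynomial (Fin M) ℂ) B r) = eval (fun i => f z i) r := by
    intro z hz
    let φ : B →ₐ[ℂ] ℂ := Ideal.Quotient.liftₐ (vanishIdeal A) (aeval (fun i => z i)) (by
      intro p hp
      have := (hmemI p).mp hp z hz
      simpa [evalAt] using this)
    have h1 : ∀ p, φ (mk p) = evalAt z p := by
      intro p
      have : φ (mk p) = aeval (fun i => z i) p := rfl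
      rw [this]
      simp [evalAt]
    refine ⟨φ, h1, fun r => ?_⟩
    rw [halgθ]
    have : φ.comp θ = aeval (fun i => f z i) := by
      apply MvPolynomial.algHom_ext
      intro j
      simp [θ, h1, hP z hz]
    have := DFunLike.congr_fun this r
    simpa using this
  have hpt' : ∀ φ : B →ₐ[ℂ] ℂ, ∃ z ∈ A, (∀ p, φ (mk p) = evalAt z p) := by
    intro φ
    let z : EuclideanSpace ℂ (Fin N) := WithLp.toLp 2 (fun i => φ (mk (MvPolynomial.X i)))
    have h1 : ∀ p, φ (mk p) = evalAt z p := by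
      intro p
      have : φ.comp mk = aeval (fun i => z i) := by
        apply MvPolynomial.algHom_ext
        intro j
        simp [z]
      have := DFunLike.congr_fun this p
      simpa [evalAt] using this
    refine ⟨z, ?_, h1⟩
    rw [hS]
    intro p hp
    rw [← h1, hmk0 p, map_zero]
    rw [hmemI]
    intro z hz
    rw [hS] at hz
    exact hz p hp
  have hptf : ∀ (φ : B →ₐ[ℂ] ℂ) (w : Fin M → ℂ),
      (∀ r, φ (algebraMap (MvPolynomial (Fin M) ℂ) B r) = eval w r) →
      ∃ z ∈ A, (∀ p, φ (mk p) = evalAt z p) ∧ f z = WithLp.toLp 2 w := by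
    intro φ w hφ
    obtain ⟨z, hz, hz2⟩ := hpt' φ
    refine ⟨z, hz, hz2, ?_⟩
    ext j
    have := hφ (MvPolynomial.X j)
    rw [halgθ] at this
    simp only [θ, aeval_X, eval_X, hz2] at this
    rw [hP z hz j, this]
  have hinj : Function.Injective (algebraMap (MvPolynomial (Fin M) ℂ) B) := by
    rw [injective_iff_map_eq_zero]
    intro r hr
    apply MvPolynomial.funext
    intro w
    have hw : (WithLp.toLp 2 w : EuclideanSpace ℂ (Fin M)) ∈ f '' A := by rw [hsurj]; trivial
    obtain ⟨z, hz, hzw⟩ := hw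
    obtain ⟨φ, -, hφ⟩ := hpt z hz
    have := hφ r
    rw [hr, map_zero, hzw] at this
    simpa using this.symm
  have hbd : ∀ x : B, ∀ w0 : Fin M → ℂ, ∃ C : ℝ, ∀ᶠ w in nhds w0, ∀ φ : B →ₐ[ℂ] ℂ,
      (∀ r, φ (algebraMap (MvPolynomial (Fin M) ℂ) B r) = eval w r) → ‖φ x‖ ≤ C := by
    intro x w0
    obtain ⟨p, rfl⟩ := hmk x
    have hK : IsCompact ((fun w : Fin M → ℂ => (WithLp.toLp 2 w : EuclideanSpace ℂ (Fin M))) ''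
        Metric.closedBall w0 1) :=
      (isCompact_closedBall w0 1).image (PiLp.continuous_toLp 2 _)
    obtain ⟨C, hC⟩ := (hproper _ hK).exists_bound_of_continuousOn (continuous_evalAt p).continuousOn
    refine ⟨C, ?_⟩
    filter_upwards [Metric.closedBall_mem_nhds w0 one_pos] with w hw φ hφ
    obtain ⟨z, hz, h1, h2⟩ := hptf φ w hφ
    rw [h1]
    exact hC z ⟨hz, ⟨w, hw, h2.symm⟩⟩
  have hIntegral := A5 hinj hbd
  have hfs : FaithfulSMul (MvPolynomial (Fin M) ℂ) B := (faithfulSMul_iff_algebraMap_injective _ _).mpr hinj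
  refine ⟨(minpoly (MvPolynomial (Fin M) ℂ) (mk q)).natDegree, fun k => ⟨minpoly (MvPolynomial (Fin M) ℂ) (mk q ^ k),
    minpoly.monic (hIntegral _), A7 hIntegral (mk q) k, ?_, ?_⟩⟩
  · intro z hz
    obtain ⟨φ, h1, h2⟩ := hpt z hz
    have h3 : φ (Polynomial.aeval (mk q ^ k) (minpoly (MvPolynomial (Fin M) ℂ) (mk q ^ k))) = 0 := by
      rw [minpoly.aeval, map_zero]
    rw [Polynomial.aeval_def, ← AlgHom.coe_toRingHom, Polynomial.hom_eval₂] at h3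
    rw [Polynomial.eval_map, ← h1, ← map_pow]
    have h5 : (φ : B →+* ℂ).comp (algebraMap (MvPolynomial (Fin M) ℂ) B) =
        eval (fun i => f z i) := RingHom.ext h2
    rw [h5] at h3
    exact h3
  · intro w t ht
    obtain ⟨φ, h1, h2⟩ := A6 hinj hIntegral (mk q ^ k) (fun i => w i) t (by rw [evWT_apply]; exact ht)
    obtain ⟨z, hz, h3, h4⟩ := hptf φ _ h1
    refine ⟨z, hz, h4, ?_⟩
    rw [← h2, map_pow, h3]


lemma norm_coord_le {n : ℕ} (z : EuclideanSpace ℂ (Fin n)) (i : Fin n) : ‖z i‖ ≤ ‖z‖ :=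
  PiLp.norm_apply_le z i

lemma G1 {n : ℕ} (p : MvPolynomial (Fin n) ℂ) : ∃ C : ℝ, 0 < C ∧
    ∀ z : EuclideanSpace ℂ (Fin n), ‖evalAt z p‖ ≤ C * (1 + ‖z‖) ^ p.totalDegree := by
  refine ⟨1 + ∑ d ∈ p.support, ‖coeff d p‖, by positivity, fun z => ?_⟩
  have h1 : (1 : ℝ) ≤ 1 + ‖z‖ := by linarith [norm_nonneg z]
  have h0 : (0 : ℝ) ≤ 1 + ‖z‖ := by linarith
  have key : ‖evalAt z p‖ ≤ ∑ d ∈ p.support, ‖coeff d p‖ * (1 + ‖z‖) ^ p.totalDegree := by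
    unfold evalAt
    rw [eval_eq]
    refine (norm_sum_le _ _).trans (Finset.sum_le_sum fun d hd => ?_)
    rw [norm_mul]
    refine mul_le_mul_of_nonneg_left ?_ (norm_nonneg _)
    rw [norm_prod]
    calc ∏ i ∈ d.support, ‖z i ^ d i‖ ≤ ∏ i ∈ d.support, (1 + ‖z‖) ^ d i := by
          refine Finset.prod_le_prod (fun _ _ => norm_nonneg _) fun i _ => ?_
          rw [norm_pow]
          exact pow_le_pow_left₀ (norm_nonneg _) ((norm_coord_le z i).trans (by linarith)) _
      _ = (1 + ‖z‖) ^ (∑ i ∈ d.support, d i) := Finset.prod_pow_eq_pow_sum _ _ _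
      _ ≤ _ := pow_le_pow_right₀ h1 (le_totalDegree hd)
  rw [← Finset.sum_mul] at key
  refine key.trans (mul_le_mul_of_nonneg_right ?_ (by positivity))
  linarith

lemma eval_smul_hc {n : ℕ} (a : MvPolynomial (Fin n) ℂ) (v : Fin n → ℂ) (t : ℂ) :
    eval (fun i => t * v i) a =
      ∑ j ∈ Finset.range (a.totalDegree + 1), t ^ j * eval v (homogeneousComponent j a) := by
  conv_lhs => rw [← sum_homogeneousComponent a]
  rw [map_sum]
  refine Finset.sum_congr rfl fun j _ => ?_
  have hh := homogeneousComponent_isHomogeneous j a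
  rw [eval_eq, eval_eq, Finset.mul_sum]
  refine Finset.sum_congr rfl fun d hd => ?_
  have h2 : d.degree = j := by
    rw [Finsupp.degree_eq_weight_one]
    exact hh (mem_support_iff.mp hd)
  simp_rw [mul_pow]
  rw [Finset.prod_mul_distrib, Finset.prod_pow_eq_pow_sum]
  have : ∑ i ∈ d.support, d i = j := h2
  rw [this]; ring

lemma hc_ne_zero {n : ℕ} (a : MvPolynomial (Fin n) ℂ) (ha : a ≠ 0) :
    homogeneousComponent a.totalDegree a ≠ 0 := by
  obtain ⟨d, hd, hd2⟩ := Finset.exists_mem_eq_sup a.support (support_nonempty.mpr ha)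
    (fun s : Fin n →₀ ℕ => s.sum fun _ e => e)
  intro h
  have h3 := congrArg (coeff d) h
  rw [coeff_homogeneousComponent, if_pos (by exact hd2.symm)] at h3
  exact (mem_support_iff.mp hd) (by simpa using h3)

lemma G2 {n : ℕ} (a : MvPolynomial (Fin n) ℂ) (s C : ℝ) (hs : 0 ≤ s) (hC : 0 ≤ C)
    (h : ∀ w : EuclideanSpace ℂ (Fin n), ‖evalAt w a‖ ≤ C * (1 + ‖w‖) ^ s) :
    (a.totalDegree : ℝ) ≤ s := by
  by_contra hlt
  push Not at hlt
  have ha : a ≠ 0 := by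
    rintro rfl
    simp at hlt
    linarith
  apply hc_ne_zero a ha
  apply MvPolynomial.funext
  intro v
  rw [map_zero]
  set D := a.totalDegree with hD
  have lim1 : Tendsto (fun t : ℝ => ((t : ℂ) ^ D)⁻¹ * eval (fun i => (t : ℂ) * v i) a) atTop
      (nhds (eval v (homogeneousComponent D a))) := by
    have e : ∀ t : ℝ, ((t : ℂ) ^ D)⁻¹ * eval (fun i => (t : ℂ) * v i) a =
        ∑ j ∈ Finset.range (D + 1), (((t : ℂ) ^ D)⁻¹ * (t : ℂ) ^ j) *
          eval v (homogeneousComponent j a) := by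
      intro t
      rw [eval_smul_hc, Finset.mul_sum]
      exact Finset.sum_congr rfl fun j _ => by ring
    simp_rw [e]
    rw [show eval v (homogeneousComponent D a) = ∑ j ∈ Finset.range (D + 1),
      (if j = D then 1 else 0) * eval v (homogeneousComponent j a) by simp]
    refine tendsto_finsetSum _ fun j hj => Tendsto.mul_const _ ?_
    have hj' : j ≤ D := by simpa [Nat.lt_succ_iff] using hj
    split_ifs with hjD
    · subst hjD
      refine tendsto_const_nhds.congr' ?_
      filter_upwards [eventually_gt_atTop 0] with t ht
      rw [inv_mul_cancel₀]
      exact pow_ne_zero _ (by exact_mod_cast ht.ne')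
    · have hlt : j < D := lt_of_le_of_ne hj' hjD
      have : Tendsto (fun t : ℝ => (((t ^ (D - j))⁻¹ : ℝ) : ℂ)) atTop (nhds ((0 : ℝ) : ℂ)) :=
        (Complex.continuous_ofReal.tendsto _).comp
          (tendsto_inv_atTop_zero.comp (tendsto_pow_atTop (by omega)))
      rw [Complex.ofReal_zero] at this
      refine this.congr' ?_
      filter_upwards [eventually_gt_atTop 0] with t ht
      have ht' : (t : ℂ) ≠ 0 := by exact_mod_cast ht.ne'
      push_cast
      rw [show D = (D - j) + j by omega, pow_add]
      simp
      field_simp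
  refine tendsto_nhds_unique lim1 ?_
  set nv : ℝ := ‖(WithLp.toLp 2 v : EuclideanSpace ℂ (Fin n))‖
  have hnv : 0 ≤ nv := norm_nonneg _
  have lim2 : Tendsto (fun t : ℝ => (C * (1 + nv) ^ s) * t ^ (-((D : ℝ) - s))) atTop (nhds 0) := by
    simpa using (tendsto_rpow_neg_atTop (sub_pos.mpr hlt)).const_mul (C * (1 + nv) ^ s)
  refine squeeze_zero_norm' ?_ lim2
  filter_upwards [eventually_ge_atTop 1] with t ht
  have ht0 : 0 < t := by linarith
  have h1 := h ((t : ℂ) • WithLp.toLp 2 v)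
  have e1 : evalAt ((t : ℂ) • (WithLp.toLp 2 v : EuclideanSpace ℂ (Fin n))) a
      = eval (fun i => (t : ℂ) * v i) a := by
    simp [evalAt]
  rw [e1, norm_smul] at h1
  rw [norm_mul, norm_inv, norm_pow]
  have hn : ‖(t : ℂ)‖ = t := by simp [abs_of_pos ht0]
  rw [hn] at h1 ⊢
  have h2 : (1 + t * nv) ^ s ≤ (1 + nv) ^ s * t ^ s := by
    rw [← Real.mul_rpow (by positivity) ht0.le]
    exact Real.rpow_le_rpow (by positivity) (by nlinarith) hs
  calc (t ^ D)⁻¹ * ‖eval (fun i => (t : ℂ) * v i) a‖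
      ≤ (t ^ D)⁻¹ * (C * ((1 + nv) ^ s * t ^ s)) := by
        gcongr
        exact h1.trans (mul_le_mul_of_nonneg_left h2 hC)
    _ = _ := by
        rw [neg_sub, Real.rpow_sub ht0, Real.rpow_natCast]
        field_simp

lemma G3 (p : Polynomial ℂ) (hp : p.Monic) (E H : ℝ) (hE : 0 < E) (hH : 0 ≤ H)
    (hc : ∀ j < p.natDegree, ‖p.coeff j‖ ≤ H * E ^ (p.natDegree - j)) (t : ℂ)
    (ht : p.eval t = 0) : ‖t‖ ≤ (1 + H * p.natDegree) * E := by
  set μ := p.natDegree with hμ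
  have hHμ : 0 ≤ H * μ := by positivity
  by_contra hlt
  push Not at hlt
  have hEt : E ≤ ‖t‖ := by nlinarith
  have ht0 : 0 < ‖t‖ := lt_of_lt_of_le hE hEt
  rw [Polynomial.eval_eq_sum_range, Finset.sum_range_succ, ← hμ] at ht
  have hlead : p.coeff μ = 1 := hp
  rw [hlead, one_mul] at ht
  have h1 : ‖t‖ ^ μ ≤ ∑ j ∈ Finset.range μ, H * E * ‖t‖ ^ (μ - 1) := by
    rw [← norm_pow, eq_neg_of_add_eq_zero_right ht, norm_neg]
    refine (norm_sum_le _ _).trans (Finset.sum_le_sum fun j hj => ?_)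
    have hj' : j < μ := Finset.mem_range.mp hj
    rw [norm_mul, norm_pow]
    calc ‖p.coeff j‖ * ‖t‖ ^ j ≤ (H * E ^ (μ - j)) * ‖t‖ ^ j := by gcongr; exact hc j hj'
      _ = H * E * (E ^ (μ - j - 1) * ‖t‖ ^ j) := by
          rw [show μ - j = (μ - j - 1) + 1 by omega, pow_succ]
          simp; ring
      _ ≤ H * E * (‖t‖ ^ (μ - j - 1) * ‖t‖ ^ j) := by gcongr
      _ = _ := by rw [← pow_add]; congr 2; omega
  rw [Finset.sum_const, Finset.card_range, nsmul_eq_mul] at h1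
  rcases Nat.eq_zero_or_pos μ with h0 | h0
  · rw [h0] at h1; simp at h1; linarith
  · rw [show ‖t‖ ^ μ = ‖t‖ * ‖t‖ ^ (μ - 1) by rw [← pow_succ']; congr 1; omega] at h1
    have h2 : ‖t‖ * ‖t‖ ^ (μ - 1) ≤ (H * μ * E) * ‖t‖ ^ (μ - 1) := by linarith
    have h3 := le_of_mul_le_mul_right h2 (by positivity)
    nlinarith

lemma G4 (a b Λ : ℝ) (ha : 0 ≤ a) (hb : 0 < b) (h : ∀ k : ℕ, a ^ k ≤ Λ * b ^ k) : a ≤ b := by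
  by_contra hlt
  push Not at hlt
  have h1 : 1 < a / b := (one_lt_div hb).mpr hlt
  obtain ⟨k, hk⟩ := pow_unbounded_of_one_lt Λ h1
  rw [div_pow, lt_div_iff₀ (by positivity)] at hk
  linarith [h k]


lemma norm_le_sum_coord {n : ℕ} (z : EuclideanSpace ℂ (Fin n)) : ‖z‖ ≤ ∑ i, ‖z i‖ := by
  have h0 : (0 : ℝ) ≤ ∑ i, ‖z i‖ := Finset.sum_nonneg fun _ _ => norm_nonneg _
  rw [EuclideanSpace.norm_eq]
  refine (Real.sqrt_le_left h0).mpr ?_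
  exact Finset.sum_sq_le_sq_sum_of_nonneg fun _ _ => norm_nonneg _

lemma unif_growth {n : ℕ} {ι : Type*} (s : Finset ι) (p : ι → MvPolynomial (Fin n) ℂ) :
    ∃ C : ℝ, 1 ≤ C ∧ ∃ D : ℕ, 1 ≤ D ∧ ∀ i ∈ s, ∀ z : EuclideanSpace ℂ (Fin n),
      ‖evalAt z (p i)‖ ≤ C * (1 + ‖z‖) ^ D := by
  choose C hC h using fun i => G1 (p i)
  have hC0 : 0 ≤ ∑ i ∈ s, C i := Finset.sum_nonneg fun i _ => (hC i).le
  refine ⟨1 + ∑ i ∈ s, C i, by linarith, 1 + ∑ i ∈ s, (p i).totalDegree, by omega, fun i hi z => ?_⟩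
  refine (h i z).trans ?_
  have h1 : C i ≤ ∑ i ∈ s, C i := Finset.single_le_sum (fun i _ => (hC i).le) hi
  have h2 : (p i).totalDegree ≤ ∑ i ∈ s, (p i).totalDegree :=
    Finset.single_le_sum (f := fun i => (p i).totalDegree) (fun i _ => Nat.zero_le _) hi
  have hz := norm_nonneg z
  refine mul_le_mul (by linarith) (pow_le_pow_right₀ (by linarith) (by omega)) (by positivity)
    (by linarith)

/-- the algebraic input: characteristic equations for powers of polynomials. -/
def KeyH {N M : ℕ} (A : Set (EuclideanSpace ℂ (Fin N)))
    (f : EuclideanSpace ℂ (Fin N) → EuclideanSpace ℂ (Fin M)) : Prop :=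
  ∀ q : MvPolynomial (Fin N) ℂ,
    ∃ m : ℕ, ∀ k : ℕ, ∃ P : Polynomial (MvPolynomial (Fin M) ℂ), P.Monic ∧ P.natDegree ≤ m ∧
      (∀ z ∈ A, (P.map (eval (fun i => f z i))).eval (evalAt z q ^ k) = 0) ∧
      ∀ (w : EuclideanSpace ℂ (Fin M)) (t : ℂ), (P.map (eval (fun i => w i))).eval t = 0 →
        ∃ z ∈ A, f z = w ∧ evalAt z q ^ k = t

lemma inv_growth {N M : ℕ} {A : Set (EuclideanSpace ℂ (Fin N))}
    {f : EuclideanSpace ℂ (Fin N) → EuclideanSpace ℂ (Fin M)} (hk : KeyH A f) :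
    ∃ C : ℝ, 0 < C ∧ ∃ D : ℕ, 1 ≤ D ∧ ∀ z ∈ A, ‖z‖ ≤ C * (1 + ‖f z‖) ^ D := by
  have hi : ∀ i : Fin N, ∃ C : ℝ, 0 < C ∧ ∃ D : ℕ, 1 ≤ D ∧ ∀ z ∈ A,
      ‖z i‖ ≤ C * (1 + ‖f z‖) ^ D := by
    intro i
    obtain ⟨m, hm⟩ := hk (X i)
    obtain ⟨P, hP, -, hroot, -⟩ := hm 1
    obtain ⟨C, hC, D, hD, hb⟩ := unif_growth (Finset.range P.natDegree) (fun j => P.coeff j)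
    refine ⟨(1 + P.natDegree) * C, by positivity, D, hD, fun z hz => ?_⟩
    have h1 := hroot z hz
    have e : evalAt z (X i) ^ 1 = z i := by simp [evalAt]
    rw [e] at h1
    have hz0 := norm_nonneg (f z)
    have hE : 1 ≤ C * (1 + ‖f z‖) ^ D := one_le_mul_of_one_le_of_one_le hC
      (one_le_pow₀ (by linarith))
    have hdeg : (P.map (eval (fun i => f z i))).natDegree = P.natDegree := hP.natDegree_map _
    have h2 := G3 _ (hP.map _) (C * (1 + ‖f z‖) ^ D) 1 (by linarith) zero_le_one (fun j hj => by
      rw [hdeg] at hj ⊢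
      rw [one_mul, Polynomial.coeff_map]
      exact (hb j (Finset.mem_range.mpr hj) (f z)).trans
        (le_self_pow₀ hE (by omega))) _ h1
    rw [hdeg] at h2
    linarith
  choose C hC D hD h using hi
  have hC0 : 0 ≤ ∑ i, C i := Finset.sum_nonneg fun i _ => (hC i).le
  refine ⟨1 + ∑ i, C i, by linarith, 1 + ∑ i, D i, by omega, fun z hz => ?_⟩
  have hz0 := norm_nonneg (f z)
  calc ‖z‖ ≤ ∑ i, ‖z i‖ := norm_le_sum_coord z
    _ ≤ ∑ i, C i * (1 + ‖f z‖) ^ (1 + ∑ i, D i) := by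
        refine Finset.sum_le_sum fun i _ => (h i z hz).trans ?_
        have h2 : D i ≤ ∑ i, D i := Finset.single_le_sum (fun i _ => Nat.zero_le _) (Finset.mem_univ i)
        exact mul_le_mul_of_nonneg_left (pow_le_pow_right₀ (by linarith) (by omega)) (hC i).le
    _ = (∑ i, C i) * (1 + ‖f z‖) ^ (1 + ∑ i, D i) := by rw [Finset.sum_mul]
    _ ≤ _ := mul_le_mul_of_nonneg_right (by linarith) (by positivity)

/-- admissible exponents. -/
def TSet {N M : ℕ} (A : Set (EuclideanSpace ℂ (Fin N)))
    (f : EuclideanSpace ℂ (Fin N) → EuclideanSpace ℂ (Fin M)) : Set ℝ :=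
  {d | ∃ C : ℝ, 0 < C ∧ ∃ R : ℝ, 0 < R ∧ ∀ z ∈ A, R < ‖z‖ → C * ‖z‖ ^ d < ‖f z‖}

lemma exists_pos_T {N M : ℕ} {A : Set (EuclideanSpace ℂ (Fin N))}
    {f : EuclideanSpace ℂ (Fin N) → EuclideanSpace ℂ (Fin M)} (hk : KeyH A f) :
    ∃ d ∈ TSet A f, 0 < d := by
  obtain ⟨C, hC, D, hD, h⟩ := inv_growth hk
  have hD0 : (0 : ℝ) < D := by exact_mod_cast hD
  set C' : ℝ := C ^ (1 / (D : ℝ)) with hC'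
  have hC'0 : 0 < C' := Real.rpow_pos_of_pos hC _
  refine ⟨1 / D, ⟨1 / (2 * C'), by positivity, (2 * C') ^ D, by positivity, fun z hz hR => ?_⟩,
    by positivity⟩
  have hz0 := norm_nonneg (f z)
  have h1 : ‖z‖ ^ (1 / (D : ℝ)) ≤ C' * (1 + ‖f z‖) := by
    have := Real.rpow_le_rpow (norm_nonneg _) (h z hz) (show 0 ≤ 1 / (D : ℝ) by positivity)
    rw [Real.mul_rpow hC.le (by positivity), one_div, Real.pow_rpow_inv_natCast (by linarith)
      (by omega)] at this
    rw [hC', one_div]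
    exact this
  have h2 : 2 * C' < ‖z‖ ^ (1 / (D : ℝ)) := by
    have := Real.rpow_lt_rpow (by positivity) hR (show 0 < 1 / (D : ℝ) by positivity)
    rwa [one_div, Real.pow_rpow_inv_natCast (by positivity) (by omega), ← one_div] at this
  rw [one_div_mul_eq_div, div_lt_iff₀ (by positivity)]
  nlinarith

lemma f_growth {N M : ℕ} {A : Set (EuclideanSpace ℂ (Fin N))}
    {f : EuclideanSpace ℂ (Fin N) → EuclideanSpace ℂ (Fin M)} (hpoly : IsPolyMapOn f A) :
    ∃ C : ℝ, 0 < C ∧ ∃ D : ℕ, ∀ z ∈ A, ‖f z‖ ≤ C * (1 + ‖z‖) ^ D := by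
  obtain ⟨P, hP⟩ := hpoly
  obtain ⟨C, hC, D, hD, hb⟩ := unif_growth Finset.univ P
  refine ⟨(M + 1) * C, by positivity, D, fun z hz => ?_⟩
  have hz0 := norm_nonneg z
  calc ‖f z‖ ≤ ∑ i, ‖f z i‖ := norm_le_sum_coord _
    _ ≤ ∑ i : Fin M, C * (1 + ‖z‖) ^ D := Finset.sum_le_sum fun i _ => by
        rw [hP z hz i]; exact hb i (Finset.mem_univ _) z
    _ = M * (C * (1 + ‖z‖) ^ D) := by simp
    _ ≤ _ := by
        rw [mul_assoc]
        exact mul_le_mul_of_nonneg_right (by linarith) (by positivity)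

lemma M_ne_zero {N M : ℕ} {A : Set (EuclideanSpace ℂ (Fin N))}
    {f : EuclideanSpace ℂ (Fin N) → EuclideanSpace ℂ (Fin M)} (hk : KeyH A f)
    (hinf : A.Infinite) : M ≠ 0 := by
  rintro rfl
  apply hinf
  choose m hm using fun i : Fin N => hk (X i)
  choose P hP _ hroot _ using fun i => hm i 1
  have hfin : (Set.pi Set.univ (fun i : Fin N =>
      {t : ℂ | t ∈ ((P i).map (eval (fun j : Fin 0 => (0 : ℂ)))).roots})).Finite := by
    refine Set.Finite.pi fun i => ?_
    exact Multiset.finite_toSet _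
  refine Set.Finite.of_finite_image (f := fun z : EuclideanSpace ℂ (Fin N) => fun i => z i)
    (hfin.subset ?_) ?_
  · rintro _ ⟨z, hz, rfl⟩ i -
    have h1 := hroot i z hz
    have e : evalAt z (X i) ^ 1 = z i := by simp [evalAt]
    rw [e] at h1
    have e2 : (fun j : Fin 0 => f z j) = fun j => 0 := funext fun j => j.elim0
    rw [e2] at h1
    exact (Polynomial.mem_roots (((hP i).map _).ne_zero)).mpr h1
  · intro z _ z' _ h
    ext i
    exact congrFun h i

lemma A_unbdd {N M : ℕ} {A : Set (EuclideanSpace ℂ (Fin N))}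
    {f : EuclideanSpace ℂ (Fin N) → EuclideanSpace ℂ (Fin M)} (hM : M ≠ 0)
    (hpoly : IsPolyMapOn f A) (hsurj : f '' A = Set.univ) (R : ℝ) : ∃ z ∈ A, R < ‖z‖ := by
  obtain ⟨C, hC, D, h⟩ := f_growth hpoly
  by_contra hcon
  push Not at hcon
  set B : ℝ := C * (1 + |R|) ^ D with hB
  have hB0 : 0 ≤ B := by positivity
  let i0 : Fin M := ⟨0, Nat.pos_of_ne_zero hM⟩
  have : EuclideanSpace.single i0 ((B + 1 : ℝ) : ℂ) ∈ f '' A := by rw [hsurj]; trivial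
  obtain ⟨z, hz, he⟩ := this
  have h1 := h z hz
  rw [he, EuclideanSpace.norm_single, Complex.norm_real, Real.norm_of_nonneg (by linarith)] at h1
  have h2 : C * (1 + ‖z‖) ^ D ≤ B := by
    rw [hB]
    gcongr
    exact (hcon z hz).trans (le_abs_self R)
  linarith

lemma T_bdd {N M : ℕ} {A : Set (EuclideanSpace ℂ (Fin N))}
    {f : EuclideanSpace ℂ (Fin N) → EuclideanSpace ℂ (Fin M)} (hM : M ≠ 0)
    (hpoly : IsPolyMapOn f A) (hsurj : f '' A = Set.univ) : ∃ D : ℝ, ∀ d ∈ TSet A f, d ≤ D := by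
  obtain ⟨C, hC, D, h⟩ := f_growth hpoly
  refine ⟨D, fun d hd => ?_⟩
  obtain ⟨c, hc, R, hR, hT⟩ := hd
  by_contra hlt
  push Not at hlt
  have ht := (tendsto_rpow_atTop (sub_pos.mpr hlt)).eventually_gt_atTop (C * 2 ^ D / c)
  obtain ⟨R1, hR1⟩ := eventually_atTop.mp ht
  obtain ⟨z, hz, hzR⟩ := A_unbdd hM hpoly hsurj (1 + R + |R1|)
  have h1 : 1 < ‖z‖ := by linarith [abs_nonneg R1]
  have h2 := hR1 ‖z‖ (by linarith [le_abs_self R1])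
  have h3 := hT z hz (by linarith [abs_nonneg R1])
  have h4 := h z hz
  have h5 : C * (1 + ‖z‖) ^ D ≤ C * 2 ^ D * ‖z‖ ^ D := by
    rw [mul_assoc, ← mul_pow]
    gcongr
    linarith
  rw [Real.rpow_sub (by linarith), Real.rpow_natCast, div_lt_div_iff₀ hc (by positivity)] at h2
  linarith


lemma BW {n : ℕ} {K : Set (EuclideanSpace ℂ (Fin n))} (hK : K.Nonempty)
    (w0 : EuclideanSpace ℂ (Fin n)) (v : ℝ) (hv0 : 0 ≤ v) (hV : greenV K w0 ≤ (v : EReal))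
    (a : MvPolynomial (Fin n) ℂ) (H s : ℝ) (hH : 0 < H) (ha : ∀ w ∈ K, ‖evalAt w a‖ ≤ H)
    (hs : (a.totalDegree : ℝ) ≤ s) : ‖evalAt w0 a‖ ≤ H * Real.exp (v * s) := by
  have hs0 : 0 ≤ s := le_trans (Nat.cast_nonneg _) hs
  rcases Nat.eq_zero_or_pos a.totalDegree with h0 | h0
  · obtain ⟨w, hw⟩ := hK
    have h1 := ha w hw
    rw [totalDegree_eq_zero_iff_eq_C.mp h0] at h1 ⊢
    simp only [evalAt, eval_C] at h1 ⊢
    have : 1 ≤ Real.exp (v * s) := Real.one_le_exp (by positivity)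
    nlinarith
  · have hH' : (H : ℂ) ≠ 0 := by exact_mod_cast hH.ne'
    have hane : a ≠ 0 := by rintro rfl; simp at h0
    set q : MvPolynomial (Fin n) ℂ := C ((H : ℂ)⁻¹) * a with hq
    have hdeg : q.totalDegree = a.totalDegree := by
      rw [hq, totalDegree_mul_of_isDomain (by simpa using hH') hane, totalDegree_C, zero_add]
    have hev : ∀ w, ‖evalAt w q‖ = ‖evalAt w a‖ / H := by
      intro w
      simp only [evalAt, hq, map_mul, eval_C, norm_mul, norm_inv, Complex.norm_real]
      rw [Real.norm_of_nonneg hH.le, inv_mul_eq_div]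
    have h1 : ((((q.totalDegree : ℝ)⁻¹ * max (Real.log ‖evalAt w0 q‖) 0 : ℝ)) : EReal) ≤ v := by
      refine le_trans (le_sSup ?_) hV
      exact ⟨q, by omega, fun w hw => by rw [hev, div_le_one hH]; exact ha w hw, rfl⟩
    rw [EReal.coe_le_coe_iff, hdeg, hev, inv_mul_le_iff₀ (by exact_mod_cast h0)] at h1
    rcases (norm_nonneg (evalAt w0 a)).eq_or_lt with h2 | h2
    · rw [← h2]; positivity
    have h3 : Real.log (‖evalAt w0 a‖ / H) ≤ v * s :=
      (le_max_left _ _).trans (h1.trans (by nlinarith))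
    rw [Real.log_le_iff_le_exp (by positivity), div_le_iff₀ hH] at h3
    linarith

lemma q_growth {N M : ℕ} {A : Set (EuclideanSpace ℂ (Fin N))}
    {f : EuclideanSpace ℂ (Fin N) → EuclideanSpace ℂ (Fin M)}
    {d : ℝ} (hd : d ∈ TSet A f) (hd0 : 0 < d) (q : MvPolynomial (Fin N) ℂ) :
    ∃ C : ℝ, 0 < C ∧ ∀ z ∈ A, ‖evalAt z q‖ ≤ C * (1 + ‖f z‖) ^ ((q.totalDegree : ℝ) / d) := by
  obtain ⟨c, hc, R, hR, hT⟩ := hd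
  obtain ⟨Cq, hCq, hq⟩ := G1 q
  set C2 : ℝ := 1 + R + c⁻¹ ^ (1 / d) with hC2
  have hci : 0 < c⁻¹ ^ (1 / d) := Real.rpow_pos_of_pos (by positivity) _
  refine ⟨Cq * C2 ^ q.totalDegree, by positivity, fun z hz => (hq z).trans ?_⟩
  have hf := norm_nonneg (f z)
  have hzn := norm_nonneg z
  have hone : 1 ≤ (1 + ‖f z‖) ^ (1 / d) := Real.one_le_rpow (by linarith) (by positivity)
  have key : 1 + ‖z‖ ≤ C2 * (1 + ‖f z‖) ^ (1 / d) := by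
    by_cases hzR : R < ‖z‖
    · have h1 := hT z hz hzR
      have h2 : ‖z‖ ^ d ≤ c⁻¹ * (1 + ‖f z‖) := by
        rw [inv_mul_eq_div, le_div_iff₀ hc]
        linarith
      have h3 := Real.rpow_le_rpow (by positivity) h2 (show 0 ≤ 1 / d by positivity)
      rw [← Real.rpow_mul hzn, mul_one_div_cancel hd0.ne', Real.rpow_one,
        Real.mul_rpow (by positivity) (by positivity)] at h3
      rw [hC2]
      nlinarith
    · push Not at hzR
      rw [hC2]
      nlinarith
  calc Cq * (1 + ‖z‖) ^ q.totalDegree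
      ≤ Cq * (C2 * (1 + ‖f z‖) ^ (1 / d)) ^ q.totalDegree := by gcongr
    _ = _ := by
        rw [mul_pow, ← mul_assoc, ← Real.rpow_natCast ((1 + ‖f z‖) ^ (1 / d)),
          ← Real.rpow_mul (by positivity)]
        congr 2
        ring

lemma core {N M : ℕ} {A : Set (EuclideanSpace ℂ (Fin N))}
    {f : EuclideanSpace ℂ (Fin N) → EuclideanSpace ℂ (Fin M)} (hk : KeyH A f)
    {d : ℝ} (hd : d ∈ TSet A f) (hd0 : 0 < d) {K : Set (EuclideanSpace ℂ (Fin M))}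
    (hK : K.Nonempty) (z : EuclideanSpace ℂ (Fin N)) (hz : z ∈ A) (v : ℝ) (hv0 : 0 ≤ v)
    (hV : greenV K (f z) ≤ (v : EReal)) (q : MvPolynomial (Fin N) ℂ)
    (hq : ∀ w ∈ A ∩ f ⁻¹' K, ‖evalAt w q‖ ≤ 1) :
    ‖evalAt z q‖ ≤ Real.exp (v * ((q.totalDegree : ℝ) / d)) := by
  obtain ⟨C3, hC3, hgr⟩ := q_growth hd hd0 q
  obtain ⟨m, hm⟩ := hk q
  set r : ℝ := (q.totalDegree : ℝ) / d with hr
  have hr0 : 0 ≤ r := by positivity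
  refine G4 _ _ (1 + 2 ^ m * m) (norm_nonneg _) (Real.exp_pos _) fun k => ?_
  obtain ⟨P, hP, hPm, hroot, hpt⟩ := hm k
  set μ := P.natDegree with hμ
  have hdeg : ∀ w : EuclideanSpace ℂ (Fin M), (P.map (eval (fun i => w i))).natDegree = μ :=
    fun w => hP.natDegree_map _
  have hcoeff : ∀ (w : EuclideanSpace ℂ (Fin M)) (j : ℕ),
      (P.map (eval (fun i => w i))).coeff j = evalAt w (P.coeff j) :=
    fun w j => Polynomial.coeff_map _ _
  have hbound : ∀ (w : EuclideanSpace ℂ (Fin M)) (B : ℝ),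
      (∀ z' ∈ A, f z' = w → ‖evalAt z' q‖ ^ k ≤ B) → ∀ j,
      ‖evalAt w (P.coeff j)‖ ≤ B ^ (μ - j) * μ.choose j := by
    intro w B hB j
    rw [← hcoeff]
    refine Polynomial.coeff_le_of_roots_le j hP (IsAlgClosed.splits _) fun t ht => ?_
    obtain ⟨z', hz', hf', e⟩ := hpt w t (Polynomial.isRoot_of_mem_roots ht)
    rw [← e, norm_pow]
    exact hB z' hz' hf'
  have hdegj : ∀ j, ((P.coeff j).totalDegree : ℝ) ≤ r * k * ((μ - j : ℕ) : ℝ) := by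
    intro j
    refine G2 _ _ ((C3 ^ k) ^ (μ - j) * μ.choose j) (by positivity) (by positivity) fun w => ?_
    have h1 := hbound w (C3 ^ k * ((1 + ‖w‖) ^ r) ^ k) (fun z' hz' e => by
      rw [← mul_pow, ← e]
      exact pow_le_pow_left₀ (norm_nonneg _) (hgr z' hz') _) j
    refine h1.trans (le_of_eq ?_)
    have hw := norm_nonneg w
    rw [Real.rpow_mul (by positivity), Real.rpow_mul (by positivity), Real.rpow_natCast,
      Real.rpow_natCast, mul_pow]
    ring
  have hKj : ∀ j, ∀ w ∈ K, ‖evalAt w (P.coeff j)‖ ≤ 2 ^ m := by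
    intro j w hw
    have h1 := hbound w 1 (fun z' hz' e => pow_le_one₀ (norm_nonneg _)
      (hq z' ⟨hz', by rw [Set.mem_preimage, e]; exact hw⟩)) j
    rw [one_pow, one_mul] at h1
    refine h1.trans ?_
    have h2 : μ.choose j ≤ 2 ^ μ := Nat.choose_le_two_pow μ j
    have h3 : 2 ^ μ ≤ 2 ^ m := Nat.pow_le_pow_right (by norm_num) hPm
    exact_mod_cast h2.trans h3
  have h := G3 _ (hP.map (eval (fun i => f z i))) (Real.exp (v * r) ^ k) (2 ^ m) (by positivity)
    (by positivity) (fun j hj => by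
      rw [hdeg, hcoeff]
      refine (BW hK (f z) v hv0 hV _ _ _ (by positivity) (hKj j) (hdegj j)).trans (le_of_eq ?_)
      rw [← pow_mul, ← Real.exp_nat_mul]
      congr 2
      push_cast
      ring) _ (hroot z hz)
  rw [hdeg, norm_pow] at h
  refine h.trans ?_
  have : (μ : ℝ) ≤ m := by exact_mod_cast hPm
  gcongr

lemma green_nonneg {n : ℕ} (hn : n ≠ 0) {K : Set (EuclideanSpace ℂ (Fin n))}
    (hK : IsCompact K) (w : EuclideanSpace ℂ (Fin n)) : 0 ≤ greenV K w := by
  let i0 : Fin n := ⟨0, Nat.pos_of_ne_zero hn⟩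
  obtain ⟨B, hB⟩ := hK.isBounded.exists_norm_le
  have hB1 : 0 < |B| + 1 := by positivity
  have hne : (((|B| + 1 : ℝ) : ℂ))⁻¹ ≠ 0 := inv_ne_zero (by exact_mod_cast hB1.ne')
  set q : MvPolynomial (Fin n) ℂ := C ((((|B| + 1 : ℝ) : ℂ))⁻¹) * X i0 with hq
  have hdeg : q.totalDegree = 1 := by
    rw [hq, totalDegree_mul_of_isDomain (by simpa using hne) (X_ne_zero _), totalDegree_C,
      totalDegree_X]
  refine le_trans ?_ (le_sSup ⟨q, by omega, fun u hu => ?_, rfl⟩)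
  · rw [← EReal.coe_zero, EReal.coe_le_coe_iff]
    positivity
  · simp only [evalAt, hq, map_mul, eval_C, eval_X, norm_mul, norm_inv, Complex.norm_real]
    rw [Real.norm_of_nonneg hB1.le, inv_mul_le_iff₀ hB1]
    have := (norm_coord_le u i0).trans (hB u hu)
    linarith [le_abs_self B]

lemma step3 {N M : ℕ} {A : Set (EuclideanSpace ℂ (Fin N))}
    {f : EuclideanSpace ℂ (Fin N) → EuclideanSpace ℂ (Fin M)} (hk : KeyH A f)
    {d : ℝ} (hd : d ∈ TSet A f) (hd0 : 0 < d) {K : Set (EuclideanSpace ℂ (Fin M))}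
    (hK : K.Nonempty) (z : EuclideanSpace ℂ (Fin N)) (hz : z ∈ A) (v : ℝ) (hv0 : 0 ≤ v)
    (hV : greenV K (f z) ≤ (v : EReal)) :
    greenV (A ∩ f ⁻¹' K) z ≤ ((v / d : ℝ) : EReal) := by
  refine sSup_le ?_
  rintro x ⟨q, hdeg, hq, rfl⟩
  rw [EReal.coe_le_coe_iff]
  have h := core hk hd hd0 hK z hz v hv0 hV q hq
  have hn : (0 : ℝ) < q.totalDegree := by exact_mod_cast hdeg
  rw [inv_mul_le_iff₀ hn]
  refine max_le ?_ (by positivity)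
  rcases (norm_nonneg (evalAt z q)).eq_or_lt with h2 | h2
  · rw [← h2, Real.log_zero]; positivity
  rw [Real.log_le_iff_le_exp h2]
  refine h.trans (le_of_eq ?_)
  congr 1
  ring


/-- Let `𝒜 ⊆ ℂᴺ` be an irreducible algebraic set of positive dimension
(equiv., infinite) and `f : 𝒜 → ℂᴹ` a proper polynomial mapping on `𝒜` with `f(𝒜) = ℂᴹ`.
Then `L∞(f|𝒜)` is a positive (finite) real number and for every nonempty compact
`K ⊆ ℂᴹ` and every `z ∈ 𝒜`: `L∞(f|𝒜) · V_{f⁻¹(K)}(z) ≤ V_K(f z)`. -/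
theorem statement13 {N M : ℕ} (A : Set (EuclideanSpace ℂ (Fin N)))
    (f : EuclideanSpace ℂ (Fin N) → EuclideanSpace ℂ (Fin M))
    (halg : IsAlgebraicSet A) (hprime : (vanishIdeal A).IsPrime) (hinf : A.Infinite)
    (hpoly : IsPolyMapOn f A)
    (hproper : ∀ K : Set (EuclideanSpace ℂ (Fin M)), IsCompact K → IsCompact (A ∩ f ⁻¹' K))
    (hsurj : f '' A = Set.univ) :
    0 < lojExp f A ∧ lojExp f A < ⊤ ∧
    ∀ K : Set (EuclideanSpace ℂ (Fin M)), K.Nonempty → IsCompact K →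
      ∀ z ∈ A, lojExp f A * greenV (A ∩ f ⁻¹' K) z ≤ greenV K (f z) := by
  have hk : KeyH A f := keyProp A f halg hprime hpoly hproper hsurj
  have hM := M_ne_zero hk hinf
  obtain ⟨d0, hd0T, hd0⟩ := exists_pos_T hk
  obtain ⟨D, hD⟩ := T_bdd hM hpoly hsurj
  have hge : ∀ d ∈ TSet A f, (d : EReal) ≤ lojExp f A := fun d hd => le_sSup ⟨d, rfl, hd⟩
  have hle : ∀ B : EReal, (∀ d ∈ TSet A f, (d : EReal) ≤ B) → lojExp f A ≤ B := by
    intro B hB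
    refine sSup_le ?_
    rintro x ⟨d, rfl, hd⟩
    exact hB d hd
  have hpos : 0 < lojExp f A := lt_of_lt_of_le (by exact_mod_cast hd0) (hge d0 hd0T)
  have htop : lojExp f A < ⊤ := lt_of_le_of_lt (hle (D : EReal) fun d hd =>
    by exact_mod_cast hD d hd) (EReal.coe_lt_top D)
  refine ⟨hpos, htop, fun K hKne hK z hz => ?_⟩
  have hV0 : 0 ≤ greenV K (f z) := green_nonneg hM hK (f z)
  by_cases hVtop : greenV K (f z) = ⊤
  · rw [hVtop]; exact le_top
  obtain ⟨v, hv⟩ : ∃ v : ℝ, greenV K (f z) = v :=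
    ⟨(greenV K (f z)).toReal, (EReal.coe_toReal hVtop
      (ne_of_gt (lt_of_lt_of_le EReal.bot_lt_zero hV0))).symm⟩
  have hv0 : 0 ≤ v := by rw [hv] at hV0; exact_mod_cast hV0
  have hstep : ∀ d ∈ TSet A f, 0 < d → greenV (A ∩ f ⁻¹' K) z ≤ ((v / d : ℝ) : EReal) :=
    fun d hd hdp => step3 hk hd hdp hKne z hz v hv0 hv.le
  obtain ⟨l, hl⟩ : ∃ l : ℝ, lojExp f A = l :=
    ⟨(lojExp f A).toReal, (EReal.coe_toReal htop.ne
      (ne_of_gt (lt_of_le_of_lt bot_le hpos))).symm⟩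
  have hl0 : 0 < l := by rw [hl] at hpos; exact_mod_cast hpos
  by_cases hG : greenV (A ∩ f ⁻¹' K) z ≤ 0
  · exact le_trans (mul_nonpos_of_nonneg_of_nonpos hpos.le hG) hV0
  push Not at hG
  have hGtop : greenV (A ∩ f ⁻¹' K) z ≠ ⊤ :=
    ne_of_lt (lt_of_le_of_lt (hstep d0 hd0T hd0) (EReal.coe_lt_top _))
  obtain ⟨g, hg⟩ : ∃ g : ℝ, greenV (A ∩ f ⁻¹' K) z = g :=
    ⟨(greenV (A ∩ f ⁻¹' K) z).toReal, (EReal.coe_toReal hGtop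
      (ne_of_gt (lt_of_le_of_lt bot_le hG))).symm⟩
  have hg0 : 0 < g := by rw [hg] at hG; exact_mod_cast hG
  have hlg : lojExp f A ≤ ((v / g : ℝ) : EReal) := by
    refine hle _ fun d hd => ?_
    rw [EReal.coe_le_coe_iff, le_div_iff₀ hg0]
    rcases le_or_gt d 0 with hdn | hdp
    · nlinarith
    · have h1 := hstep d hd hdp
      rw [hg, EReal.coe_le_coe_iff, le_div_iff₀ hdp] at h1
      linarith
  rw [hl, EReal.coe_le_coe_iff, le_div_iff₀ hg0] at hlg
  rw [hl, hg, hv]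
  exact_mod_cast hlg
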